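/- For every k ∈ ℕ and every M ∈ ℝ, the family H_{k,M} is quasi-normal on the unit disk 𝔻. -/

import Mathlib

open Complex Filter Set Metric Topology

noncomputable section

/-- The open unit disk `𝔻`. -/
def unitDisk : Set ℂ := Metric.ball (0 : ℂ) 1

/-- The logarithmic derivative of `f'`, i.e. `f''/f'`. -/
def ldd (f : ℂ → ℂ) : ℂ → ℂ := fun z => deriv (deriv f) z / deriv f z

/-- `SRec n f m` is the generalized Schwarzian `S_{m+2,n}(f)`. -/
def SRec (n : ℕ) (f : ℂ → ℂ) : ℕ → ℂ → ℂ
  | 0 => ldd f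
  | m + 1 => fun z => deriv (SRec n f m) z - (1 / (n : ℂ)) * ldd f z * SRec n f m z

/-- `SGen n k f` is `S_{k,n}(f)` (for `k ≥ 2`). -/
def SGen (n k : ℕ) (f : ℂ → ℂ) : ℂ → ℂ := SRec n f (k - 2)

/-- The generalized Schwarzian derivative of order `k`: `S_k(f) = S_{k+1,k}(f)`. -/
def Sk (k : ℕ) (f : ℂ → ℂ) : ℂ → ℂ := SGen k (k + 1) f

/-- `f` is a non-constant meromorphic function on `U`: near no point of `U`
is `f` eventually equal to a constant. -/
def NonConstOn (f : ℂ → ℂ) (U : Set ℂ) : Prop :=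
  ¬ ∃ c : ℂ, ∃ z ∈ U, ∀ᶠ w in 𝓝[≠] z, f w = c

/-- `E` has no accumulation point in `U`. -/
def NoAccIn (E U : Set ℂ) : Prop := ∀ z ∈ U, ¬ AccPt z (𝓟 E)

/-- The family `M_{k,M}`: (non-constant) meromorphic functions on `𝔻` whose generalized
Schwarzian derivative `S_k(f)` is holomorphic on `𝔻` with `‖S_k(f)‖_∞ ≤ M`, i.e. it
coincides (away from a set without accumulation points in `𝔻`) with a function `g`
holomorphic on `𝔻` and bounded by `M`. -/
def MFam (k : ℕ) (M : ℝ) : Set (ℂ → ℂ) :=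
  {f | MeromorphicOn f unitDisk ∧ NonConstOn f unitDisk ∧
    ∃ g : ℂ → ℂ, AnalyticOnNhd ℂ g unitDisk ∧ (∀ z ∈ unitDisk, ‖g z‖ ≤ M) ∧
      NoAccIn {w ∈ unitDisk | Sk k f w ≠ g w} unitDisk}

/-- The family `H_{k,M} = M_{k,M} ∩ H(𝔻)`. -/
def HFam (k : ℕ) (M : ℝ) : Set (ℂ → ℂ) :=
  {f ∈ MFam k M | AnalyticOnNhd ℂ f unitDisk}

/-- The chordal (spherical) distance on the Riemann sphere `ℂ ∪ {∞}`. -/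
def sphDist (x y : OnePoint ℂ) : ℝ :=
  Option.elim x (Option.elim y 0 fun w => 1 / Real.sqrt (1 + ‖w‖ ^ 2))
    fun z =>
      Option.elim y (1 / Real.sqrt (1 + ‖z‖ ^ 2)) fun w =>
        ‖z - w‖ / (Real.sqrt (1 + ‖z‖ ^ 2) * Real.sqrt (1 + ‖w‖ ^ 2))

/-- Locally uniform convergence on `U` with respect to the spherical metric. -/
def TendstoLocUnifSph (F : ℕ → ℂ → ℂ) (g : ℂ → OnePoint ℂ) (U : Set ℂ) : Prop :=
  ∀ ε > (0 : ℝ), ∀ x ∈ U, ∃ t ∈ 𝓝[U] x,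
    ∀ᶠ n in atTop, ∀ y ∈ t, sphDist (F n y : OnePoint ℂ) (g y) < ε

/-- A family of (meromorphic) functions is normal on `U` if every sequence has a
subsequence converging locally uniformly on `U` w.r.t. the spherical metric. -/
def NormalOn (𝓕 : Set (ℂ → ℂ)) (U : Set ℂ) : Prop :=
  ∀ F : ℕ → ℂ → ℂ, (∀ n, F n ∈ 𝓕) →
    ∃ φ : ℕ → ℕ, StrictMono φ ∧
      ∃ g : ℂ → OnePoint ℂ, TendstoLocUnifSph (fun n => F (φ n)) g U

/-- A family is quasi-normal on `U` if every sequence has a subsequence converging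
locally uniformly (spherically) off some exceptional set `E ⊆ U` without
accumulation points in `U`. -/
def QuasiNormalOn (𝓕 : Set (ℂ → ℂ)) (U : Set ℂ) : Prop :=
  ∀ F : ℕ → ℂ → ℂ, (∀ n, F n ∈ 𝓕) →
    ∃ φ : ℕ → ℕ, StrictMono φ ∧ ∃ E : Set ℂ, E ⊆ U ∧ NoAccIn E U ∧
      ∃ g : ℂ → OnePoint ℂ, TendstoLocUnifSph (fun n => F (φ n)) g (U \ E)

/-- A family is locally uniformly bounded on `U`. -/
def LocUnifBddOn (𝓕 : Set (ℂ → ℂ)) (U : Set ℂ) : Prop :=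
  ∀ x ∈ U, ∃ t ∈ 𝓝[U] x, ∃ C : ℝ, ∀ f ∈ 𝓕, ∀ y ∈ t, ‖f y‖ ≤ C

lemma eventually_nhdsNE_nhds {z₀ : ℂ} {p : ℂ → Prop} (h : ∀ᶠ z in 𝓝[≠] z₀, p z) :
    ∀ᶠ z in 𝓝[≠] z₀, ∀ᶠ w in 𝓝 z, p w := by
  filter_upwards [eventually_eventually_nhdsWithin.2 h, self_mem_nhdsWithin] with z hz hne
  rwa [isOpen_compl_singleton.nhdsWithin_eq hne] at hz

/-- At a zero of order `m ≥ 1` of `f'`, the function `S_{j+2,k}(f)` has a pole of order exactly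
`j + 1`. -/
lemma exists_SRec_eq_div_pow {k m : ℕ} (hk : 1 ≤ k) (hm : 1 ≤ m) {f G : ℂ → ℂ} {z₀ : ℂ}
    (hG : AnalyticAt ℂ G z₀) (hG0 : G z₀ ≠ 0)
    (hf : ∀ᶠ z in 𝓝 z₀, deriv f z = (z - z₀) ^ m * G z) (j : ℕ) :
    ∃ Q : ℂ → ℂ, AnalyticAt ℂ Q z₀ ∧ Q z₀ ≠ 0 ∧
      ∀ᶠ z in 𝓝[≠] z₀, SRec k f j z = Q z / (z - z₀) ^ (j + 1) := by
  have hid : AnalyticAt ℂ (fun z : ℂ => z - z₀) z₀ := by fun_prop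
  set P : ℂ → ℂ := fun z => m + (z - z₀) * (deriv G z / G z) with hP
  have hPan : AnalyticAt ℂ P z₀ := analyticAt_const.add (hid.mul (hG.deriv.div hG hG0))
  have hGne : ∀ᶠ z in 𝓝 z₀, G z ≠ 0 := hG.continuousAt.eventually_ne hG0
  have hldd : ∀ᶠ z in 𝓝[≠] z₀, ldd f z = P z / (z - z₀) := by
    filter_upwards [hf.eventually_nhds.filter_mono nhdsWithin_le_nhds,
      hGne.filter_mono nhdsWithin_le_nhds, self_mem_nhdsWithin,
      hG.eventually_analyticAt.filter_mono nhdsWithin_le_nhds] with z hz hGz hne hGa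
    have hne' : z - z₀ ≠ 0 := sub_ne_zero.2 hne
    obtain ⟨n, rfl⟩ : ∃ n, m = n + 1 := ⟨m - 1, by omega⟩
    have h1 : deriv (deriv f) z =
        ((n + 1 : ℕ) : ℂ) * (z - z₀) ^ n * G z + (z - z₀) ^ (n + 1) * deriv G z := by
      rw [Filter.EventuallyEq.deriv_eq hz]
      have := (((hasDerivAt_id z).sub_const z₀).pow (n + 1)).mul hGa.differentiableAt.hasDerivAt
      have h2 := this.deriv
      simpa [Pi.mul_def] using h2
    simp only [ldd, h1, hz.self_of_nhds, hP]
    field_simp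
    ring
  induction j with
  | zero =>
    refine ⟨P, hPan, ?_, ?_⟩
    · simp [hP]; omega
    · simpa [SRec] using hldd
  | succ j ih =>
    obtain ⟨Q, hQ, hQ0, hS⟩ := ih
    refine ⟨fun z => (z - z₀) * deriv Q z - (j + 1) * Q z - (1 / (k : ℂ)) * P z * Q z, ?_, ?_, ?_⟩
    · exact ((hid.mul hQ.deriv).sub (analyticAt_const.mul hQ)).sub
        ((analyticAt_const.mul hPan).mul hQ)
    · have hk0 : (k : ℂ) ≠ 0 := by exact_mod_cast (by omega : k ≠ 0)
      have h3 : ((k * (j + 1) + m : ℕ) : ℂ) ≠ 0 := by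
        exact_mod_cast (by omega : k * (j + 1) + m ≠ 0)
      have : (z₀ - z₀) * deriv Q z₀ - (j + 1) * Q z₀ - (1 / (k : ℂ)) * P z₀ * Q z₀ =
          -(((k * (j + 1) + m : ℕ) : ℂ) / k * Q z₀) := by
        simp only [hP]
        push_cast
        field_simp
        ring
      beta_reduce
      rw [this]
      exact neg_ne_zero.2 (mul_ne_zero (div_ne_zero h3 hk0) hQ0)
    · filter_upwards [eventually_nhdsNE_nhds hS, hldd, self_mem_nhdsWithin,
        hQ.eventually_analyticAt.filter_mono nhdsWithin_le_nhds] with z hz hl hne hQa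
      have hne' : z - z₀ ≠ 0 := sub_ne_zero.2 hne
      have h1 : deriv (SRec k f j) z = (deriv Q z * (z - z₀) ^ (j + 1)
          - Q z * ((j + 1 : ℕ) * (z - z₀) ^ j)) / ((z - z₀) ^ (j + 1)) ^ 2 := by
        rw [Filter.EventuallyEq.deriv_eq hz]
        have := hQa.differentiableAt.hasDerivAt.div
          (((hasDerivAt_id z).sub_const z₀).pow (j + 1)) (pow_ne_zero _ hne')
        have h2 := this.deriv
        simpa [Pi.div_def] using h2
      simp only [SRec, h1, hl, hz.self_of_nhds]
      push_cast
      field_simp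
      ring

lemma NoAccIn.eventually_notMem {E U : Set ℂ} (h : NoAccIn E U) {z : ℂ} (hz : z ∈ U) :
    ∀ᶠ w in 𝓝[≠] z, w ∉ E := by
  have := h z hz
  rwa [accPt_iff_frequently_nhdsNE, not_frequently] at this

lemma deriv_ne_zero_of_mem_HFam {k : ℕ} (hk : 1 ≤ k) {M : ℝ} {f : ℂ → ℂ} (hf : f ∈ HFam k M)
    {z₀ : ℂ} (hz₀ : z₀ ∈ unitDisk) : deriv f z₀ ≠ 0 := by
  obtain ⟨⟨-, hnc, g, hg, -, hacc⟩, hfan⟩ := hf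
  have hdan : AnalyticAt ℂ (deriv f) z₀ := (hfan z₀ hz₀).deriv
  have hnz : ¬ ∀ᶠ z in 𝓝 z₀, deriv f z = 0 := by
    intro h
    refine hnc ⟨f z₀, z₀, hz₀, Filter.Eventually.filter_mono nhdsWithin_le_nhds ?_⟩
    obtain ⟨r, hr, hball⟩ := Metric.eventually_nhds_iff_ball.1
      (h.and (hfan z₀ hz₀).eventually_analyticAt)
    filter_upwards [ball_mem_nhds z₀ hr] with w hw
    exact isOpen_ball.is_const_of_deriv_eq_zero (convex_ball z₀ r).isPreconnected
      (fun z hz => (hball z hz).2.differentiableAt.differentiableWithinAt)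
      (fun z hz => (hball z hz).1) hw (mem_ball_self hr)
  obtain ⟨m, G, hG, hG0, hfG⟩ := hdan.exists_eventuallyEq_pow_smul_nonzero_iff.2 hnz
  simp only [smul_eq_mul] at hfG
  rcases Nat.eq_zero_or_pos m with rfl | hm
  · simpa [hfG.self_of_nhds] using hG0
  exfalso
  obtain ⟨Q, hQ, hQ0, hS⟩ := exists_SRec_eq_div_pow hk hm hG hG0 hfG (k - 1)
  have hev : ∀ᶠ z in 𝓝[≠] z₀, Q z = g z * (z - z₀) ^ (k - 1 + 1) := by
    filter_upwards [hS, hacc.eventually_notMem hz₀, self_mem_nhdsWithin,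
      (isOpen_ball.mem_nhds hz₀ : unitDisk ∈ 𝓝 z₀) |> mem_nhdsWithin_of_mem_nhds]
      with z h1 h2 hne hzU
    have h3 : Sk k f z = g z := by
      by_contra h
      exact h2 ⟨hzU, h⟩
    have h4 : Sk k f z = SRec k f (k - 1) z := rfl
    rw [← h3, h4, h1, div_mul_cancel₀ _ (pow_ne_zero _ (sub_ne_zero.2 hne))]
  have hlim : Tendsto (fun z => g z * (z - z₀) ^ (k - 1 + 1)) (𝓝[≠] z₀) (𝓝 0) := by
    have hc : ContinuousAt (fun z => g z * (z - z₀) ^ (k - 1 + 1)) z₀ :=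
      (hg z₀ hz₀).continuousAt.mul (by fun_prop)
    have := hc.tendsto.mono_left (nhdsWithin_le_nhds (s := {z₀}ᶜ))
    simpa using this
  have hlim' : Tendsto Q (𝓝[≠] z₀) (𝓝 (Q z₀)) :=
    hQ.continuousAt.tendsto.mono_left nhdsWithin_le_nhds
  exact hQ0 (tendsto_nhds_unique hlim' (hlim.congr' (hev.mono fun z h => h.symm)))

lemma analyticOnNhd_iteratedDeriv {u : ℂ → ℂ} {U : Set ℂ} (hu : AnalyticOnNhd ℂ u U) (n : ℕ) :
    AnalyticOnNhd ℂ (iteratedDeriv n u) U := by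
  induction n with
  | zero => simpa using hu
  | succ n ih =>
    rw [iteratedDeriv_succ]
    exact ih.deriv

/-- A nowhere vanishing branch `u` of a `k`-th root of `c / f'` turns the generalized Schwarzian
into the linear expression `S_{j+2,k}(f) u = -k u^{(j+1)}`. -/
lemma exists_root_of_deriv_ne_zero {k : ℕ} (hk : 1 ≤ k) {f : ℂ → ℂ}
    (hf : AnalyticOnNhd ℂ f unitDisk) (hf' : ∀ z ∈ unitDisk, deriv f z ≠ 0) :
    ∃ (u : ℂ → ℂ) (c : ℂ), c ≠ 0 ∧ AnalyticOnNhd ℂ u unitDisk ∧ (∀ z ∈ unitDisk, u z ≠ 0) ∧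
      (∀ z ∈ unitDisk, deriv f z = c * (u z ^ k)⁻¹) ∧
      ∀ j, ∀ z ∈ unitDisk, SRec k f j z * u z = -k * iteratedDeriv (j + 1) u z := by
  have hk0 : (k : ℂ) ≠ 0 := by exact_mod_cast (by omega : k ≠ 0)
  have hldd : AnalyticOnNhd ℂ (ldd f) unitDisk := fun z hz =>
    (hf z hz).deriv.deriv.div (hf z hz).deriv (hf' z hz)
  obtain ⟨L, hL⟩ := DifferentiableOn.isExactOn_ball (c := (0 : ℂ)) (r := 1) hldd.differentiableOn
  have hu (z : ℂ) (hz : z ∈ unitDisk) : HasDerivAt (fun w => Complex.exp (-(1 / k) * L w))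
      (-(1 / k) * ldd f z * Complex.exp (-(1 / k) * L z)) z := by
    rw [mul_comm]
    exact ((hL z hz).const_mul (-(1 / k : ℂ))).cexp
  set u : ℂ → ℂ := fun w => Complex.exp (-(1 / k) * L w) with hudef
  have hu0 (z : ℂ) : u z ≠ 0 := Complex.exp_ne_zero _
  have huan : AnalyticOnNhd ℂ u unitDisk :=
    DifferentiableOn.analyticOnNhd
      (fun z hz => (hu z hz).differentiableAt.differentiableWithinAt) isOpen_ball
  have h0 : (0 : ℂ) ∈ unitDisk := mem_ball_self one_pos
  have hconst (z : ℂ) (hz : z ∈ unitDisk) : HasDerivAt (fun w => deriv f w * u w ^ k) 0 z := by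
    refine ((hf z hz).deriv.differentiableAt.hasDerivAt.mul ((hu z hz).pow k)).congr_deriv ?_
    obtain ⟨n, rfl⟩ : ∃ n, k = n + 1 := ⟨k - 1, by omega⟩
    have := hf' z hz
    simp only [ldd, Pi.pow_apply, add_tsub_cancel_right, hudef]
    field_simp
    ring
  refine ⟨u, deriv f 0 * u 0 ^ k, mul_ne_zero (hf' 0 h0) (pow_ne_zero _ (hu0 0)), huan,
    fun z _ => hu0 z, fun z hz => ?_, fun j => ?_⟩
  · have := isOpen_ball.is_const_of_deriv_eq_zero (convex_ball (0 : ℂ) 1).isPreconnected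
      (fun z hz => (hconst z hz).differentiableAt.differentiableWithinAt)
      (fun z hz => (hconst z hz).deriv) h0 hz
    rw [this, mul_assoc, mul_inv_cancel₀ (pow_ne_zero _ (hu0 z)), mul_one]
  · have key : AnalyticOnNhd ℂ (SRec k f j) unitDisk ∧
        ∀ z ∈ unitDisk, SRec k f j z * u z = -k * iteratedDeriv (j + 1) u z := by
      induction j with
      | zero =>
        refine ⟨hldd, fun z hz => ?_⟩
        rw [zero_add, iteratedDeriv_one, (hu z hz).deriv]
        simp only [SRec, hudef]
        field_simp
      | succ j ih =>
        obtain ⟨hS, hSu⟩ := ih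
        refine ⟨fun z hz => (hS z hz).deriv.sub
          ((analyticAt_const.mul (hldd z hz)).mul (hS z hz)), fun z hz => ?_⟩
        have heq : (fun w => SRec k f j w * u w) =ᶠ[𝓝 z]
            fun w => -k * iteratedDeriv (j + 1) u w := by
          filter_upwards [isOpen_ball.mem_nhds hz] with w hw using hSu w hw
        have h1 := heq.deriv_eq
        have h2 := ((hS z hz).differentiableAt.hasDerivAt.mul (hu z hz)).deriv
        rw [deriv_const_mul_field, ← iteratedDeriv_succ] at h1
        rw [← h1, ← Pi.mul_def, h2]
        simp only [SRec, hudef]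
        ring
    exact key.2

/-- A Gronwall bound for the solutions of `u^{(k)} = q u` in the disk. -/
lemma norm_le_of_iteratedDeriv_eq {k : ℕ} (hk : 1 ≤ k) {K : ℝ} (hK : 1 ≤ K) {u q : ℂ → ℂ}
    (hu : AnalyticOnNhd ℂ u unitDisk) (hq : ∀ z ∈ unitDisk, ‖q z‖ ≤ K)
    (hode : ∀ z ∈ unitDisk, iteratedDeriv k u z = q z * u z) {z : ℂ} (hz : z ∈ unitDisk) :
    ‖u z‖ ≤ ‖fun i : Fin k => iteratedDeriv i u 0‖ * Real.exp K := by
  set w : ℂ → Fin k → ℂ := fun z i => iteratedDeriv i u z with hw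
  have hseg (t : ℝ) (ht : t ∈ Icc (0 : ℝ) 1) : (t : ℂ) * z ∈ unitDisk := by
    simp only [unitDisk, mem_ball_zero_iff, norm_mul, Complex.norm_real, Real.norm_eq_abs,
      abs_of_nonneg ht.1] at hz ⊢
    nlinarith [norm_nonneg z, ht.2]
  have hder (t : ℝ) (ht : t ∈ Icc (0 : ℝ) 1) : HasDerivAt (fun s : ℝ => w (s * z))
      (fun i : Fin k => iteratedDeriv (i + 1) u (t * z) * z) t := by
    rw [hasDerivAt_pi]
    intro i
    have han : AnalyticAt ℂ (iteratedDeriv i u) (t * z) := analyticOnNhd_iteratedDeriv hu i _ (hseg t ht)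
    have h1 := han.differentiableAt.hasDerivAt
    rw [← iteratedDeriv_succ] at h1
    have h2 : HasDerivAt (fun s : ℝ => (s : ℂ) * z) z t := by
      simpa using (Complex.ofRealCLM.hasDerivAt (x := t)).mul_const z
    exact h1.comp t h2
  have hbound (t : ℝ) (ht : t ∈ Icc (0 : ℝ) 1) :
      ‖fun i : Fin k => iteratedDeriv (i + 1) u (t * z) * z‖ ≤ K * ‖w (t * z)‖ + 0 := by
    rw [add_zero]
    have hK0 : 0 ≤ K := by linarith
    refine (pi_norm_le_iff_of_nonneg (by positivity)).2 fun i => ?_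
    have hz1 : ‖z‖ ≤ 1 := (mem_ball_zero_iff.1 hz).le
    rw [norm_mul]
    refine (mul_le_of_le_one_right (norm_nonneg _) hz1).trans ?_
    rcases Nat.lt_or_ge (i + 1) k with h | h
    · have := norm_le_pi_norm (w (t * z)) ⟨i + 1, h⟩
      exact this.trans (le_mul_of_one_le_left (norm_nonneg _) hK)
    · have hik : (i : ℕ) + 1 = k := by omega
      rw [hik, hode _ (hseg t ht), norm_mul]
      have := norm_le_pi_norm (w (t * z)) ⟨0, hk⟩
      simp only [hw, iteratedDeriv_zero] at this
      exact mul_le_mul (hq _ (hseg t ht)) this (norm_nonneg _) hK0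
  have hgr := norm_le_gronwallBound_of_norm_deriv_right_le (δ := ‖w 0‖) (K := K) (ε := 0)
    (fun t ht => (hder t ht).continuousAt.continuousWithinAt)
    (fun t ht => (hder t ⟨ht.1, ht.2.le⟩).hasDerivWithinAt) (by simp)
    (fun t ht => hbound t ⟨ht.1, ht.2.le⟩) 1 (right_mem_Icc.2 zero_le_one)
  rw [gronwallBound_ε0] at hgr
  simp only [Complex.ofReal_one, one_mul, sub_zero, mul_one] at hgr
  have := norm_le_pi_norm (w z) ⟨0, hk⟩
  simp only [hw, iteratedDeriv_zero] at this
  exact this.trans hgr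

lemma exists_normalized_root {k : ℕ} (hk : 1 ≤ k) {M : ℝ} {f : ℂ → ℂ} (hf : f ∈ HFam k M) :
    ∃ (v : ℂ → ℂ) (c : ℂ), c ≠ 0 ∧ DifferentiableOn ℂ v unitDisk ∧ (∀ z ∈ unitDisk, v z ≠ 0) ∧
      (∀ z ∈ unitDisk, deriv f z = c * (v z ^ k)⁻¹) ∧
      (∀ z ∈ unitDisk, ‖v z‖ ≤ Real.exp (max 1 M)) ∧
      ‖fun i : Fin k => iteratedDeriv i v 0‖ = 1 := by
  have hf' := fun z (hz : z ∈ unitDisk) => deriv_ne_zero_of_mem_HFam hk hf hz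
  obtain ⟨⟨-, -, g, hg, hgM, hacc⟩, hfan⟩ := hf
  obtain ⟨u, c, hc, hu, hu0, hfu, hS⟩ := exists_root_of_deriv_ne_zero hk hfan hf'
  have hk0 : (k : ℂ) ≠ 0 := by exact_mod_cast (by omega : k ≠ 0)
  have hk1 : k - 1 + 1 = k := by omega
  have h0 : (0 : ℂ) ∈ unitDisk := mem_ball_self one_pos
  have hode (z : ℂ) (hz : z ∈ unitDisk) : g z * u z = -k * iteratedDeriv k u z := by
    have hcont : ContinuousAt (fun w => g w * u w - -k * iteratedDeriv k u w) z :=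
      (((hg z hz).mul (hu z hz)).sub
        (analyticAt_const.mul (analyticOnNhd_iteratedDeriv hu k z hz))).continuousAt
    have hev : ∀ᶠ w in 𝓝[≠] z, g w * u w - -k * iteratedDeriv k u w = 0 := by
      filter_upwards [hacc.eventually_notMem hz,
        mem_nhdsWithin_of_mem_nhds (isOpen_ball.mem_nhds hz : unitDisk ∈ 𝓝 z)] with w h2 hw
      have h3 : Sk k f w = g w := by
        by_contra h
        exact h2 ⟨hw, h⟩
      have h4 : Sk k f w = SRec k f (k - 1) w := rfl
      rw [← h3, h4, hS _ w hw, hk1, sub_self]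
    have := tendsto_nhds_unique (hcont.tendsto.mono_left (nhdsWithin_le_nhds (s := {z}ᶜ)))
      (tendsto_const_nhds.congr' (hev.mono fun w h => h.symm))
    exact sub_eq_zero.1 this
  have hbd := fun z (hz : z ∈ unitDisk) => norm_le_of_iteratedDeriv_eq hk (le_max_left 1 M) hu
    (q := fun w => -(g w / k)) (fun w hw => by
      rw [norm_neg, norm_div, Complex.norm_natCast]
      exact (div_le_self (norm_nonneg _) (by exact_mod_cast hk)).trans
        ((hgM w hw).trans (le_max_right _ _)))
    (fun w hw => by
      have := hode w hw
      field_simp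
      linear_combination this) hz
  set N : ℝ := ‖fun i : Fin k => iteratedDeriv i u 0‖ with hN
  have hNpos : 0 < N := by
    have := norm_le_pi_norm (fun i : Fin k => iteratedDeriv i u 0) ⟨0, hk⟩
    simp only [iteratedDeriv_zero] at this
    exact (norm_pos_iff.2 (hu0 0 h0)).trans_le this
  have hNC : (N : ℂ) ≠ 0 := by exact_mod_cast hNpos.ne'
  refine ⟨fun z => (N : ℂ)⁻¹ * u z, c * ((N : ℂ)⁻¹) ^ k, mul_ne_zero hc (pow_ne_zero _
    (inv_ne_zero hNC)), hu.differentiableOn.const_mul _,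
    fun z hz => mul_ne_zero (inv_ne_zero hNC) (hu0 z hz), fun z hz => ?_, fun z hz => ?_, ?_⟩
  · have := hu0 z hz
    rw [hfu z hz, mul_pow]
    field_simp
  · rw [norm_mul, norm_inv, Complex.norm_real, Real.norm_of_nonneg hNpos.le,
      inv_mul_le_iff₀ hNpos]
    exact hbd z hz
  · have : (fun i : Fin k => iteratedDeriv i (fun z => (N : ℂ)⁻¹ * u z) 0) =
        (N : ℂ)⁻¹ • fun i : Fin k => iteratedDeriv i u 0 := by
      ext i
      rw [iteratedDeriv_const_mul_field]
      rfl
    rw [this, norm_smul, norm_inv, Complex.norm_real, Real.norm_of_nonneg hNpos.le, ← hN,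
      inv_mul_cancel₀ hNpos.ne']

lemma isOpen_unitDisk : IsOpen unitDisk := isOpen_ball

lemma exists_radius_of_isCompact {K : Set ℂ} (hKU : K ⊆ unitDisk) (hK : IsCompact K) :
    ∃ r : ℝ, 0 ≤ r ∧ r < 1 ∧ ∀ z ∈ K, ‖z‖ ≤ r := by
  rcases K.eq_empty_or_nonempty with rfl | hne
  · exact ⟨0, le_rfl, one_pos, by simp⟩
  · obtain ⟨x, hx, hmax⟩ := hK.exists_isMaxOn hne continuous_norm.continuousOn
    exact ⟨‖x‖, norm_nonneg _, mem_ball_zero_iff.1 (hKU hx), fun z hz => hmax hz⟩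

lemma norm_taylor_coeff_le {v : ℂ → ℂ} {B : ℝ} (hv : DifferentiableOn ℂ v unitDisk)
    (hB : ∀ z ∈ unitDisk, ‖v z‖ ≤ B) (n : ℕ) :
    ‖((n.factorial : ℂ))⁻¹ * iteratedDeriv n v 0‖ ≤ B := by
  have hfac : (0 : ℝ) < n.factorial := by exact_mod_cast n.factorial_pos
  have h1 : ∀ R ∈ Ioo (0 : ℝ) 1, ‖iteratedDeriv n v 0‖ * R ^ n ≤ n.factorial * B := by
    intro R hR
    have hsub : closedBall (0 : ℂ) R ⊆ unitDisk := closedBall_subset_ball hR.2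
    have := Complex.norm_iteratedDeriv_le_of_forall_mem_sphere_norm_le n hR.1
      (DifferentiableOn.diffContOnCl_ball (hv.mono hsub) subset_rfl)
      (fun z hz => hB z (hsub (sphere_subset_closedBall hz)))
    rwa [le_div_iff₀ (pow_pos hR.1 n)] at this
  have hlim : Tendsto (fun R : ℝ => ‖iteratedDeriv n v 0‖ * R ^ n) (𝓝[<] 1)
      (𝓝 (‖iteratedDeriv n v 0‖ * 1 ^ n)) :=
    Tendsto.mono_left (Continuous.tendsto (by fun_prop) 1) nhdsWithin_le_nhds
  have := le_of_tendsto hlim (by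
    filter_upwards [Ioo_mem_nhdsLT (zero_lt_one' ℝ)] with R hR using h1 R hR)
  rw [norm_mul, norm_inv, Complex.norm_natCast, inv_mul_le_iff₀ hfac]
  simpa using this

/-- **Montel's theorem** on the unit disk, for uniformly bounded sequences. -/
lemma exists_subseq_tendstoLocallyUniformlyOn {v : ℕ → ℂ → ℂ} {B : ℝ}
    (hv : ∀ n, DifferentiableOn ℂ (v n) unitDisk) (hB : ∀ n, ∀ z ∈ unitDisk, ‖v n z‖ ≤ B) :
    ∃ φ : ℕ → ℕ, StrictMono φ ∧ ∃ V : ℂ → ℂ,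
      TendstoLocallyUniformlyOn (fun n => v (φ n)) V atTop unitDisk := by
  set A : ℕ → ℕ → ℂ := fun n j => ((j.factorial : ℂ))⁻¹ * iteratedDeriv j (v n) 0 with hA
  have hAB (n j : ℕ) : ‖A n j‖ ≤ B := norm_taylor_coeff_le (hv n) (hB n) j
  obtain ⟨a, ha, φ, hφ, hlim⟩ := (isCompact_univ_pi
    (fun _ : ℕ => isCompact_closedBall (0 : ℂ) B)).tendsto_subseq (x := A)
    (fun n j _ => mem_closedBall_zero_iff.2 (hAB n j))
  have haB (j : ℕ) : ‖a j‖ ≤ B := mem_closedBall_zero_iff.1 (ha j trivial)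
  have hB0 : 0 ≤ B := (norm_nonneg _).trans (haB 0)
  refine ⟨φ, hφ, fun z => ∑' j, a j * z ^ j, ?_⟩
  rw [tendstoLocallyUniformlyOn_iff_forall_isCompact isOpen_unitDisk]
  intro K hKU hK
  obtain ⟨r, hr0, hr1, hKr⟩ := exists_radius_of_isCompact hKU hK
  have hgeom : Summable fun j : ℕ => r ^ j := summable_geometric_of_lt_one hr0 hr1
  have hD : Tendsto (fun n => ∑' j, ‖A (φ n) j - a j‖ * r ^ j) atTop (𝓝 0) := by
    have := tendsto_tsum_of_dominated_convergence (𝓕 := atTop)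
      (f := fun n j => ‖A (φ n) j - a j‖ * r ^ j) (g := fun _ => (0 : ℝ))
      (bound := fun j => (B + B) * r ^ j) (hgeom.mul_left _) (fun j => ?_) (.of_forall fun n j => ?_)
    · simpa using this
    · have h1 := (tendsto_iff_norm_sub_tendsto_zero.1 (tendsto_pi_nhds.1 hlim j)).mul_const (r ^ j)
      simpa using h1
    · rw [norm_mul, norm_norm, norm_pow, Real.norm_of_nonneg hr0]
      exact mul_le_mul_of_nonneg_right ((norm_sub_le _ _).trans (add_le_add (hAB _ _) (haB _)))
        (by positivity)
  rw [Metric.tendstoUniformlyOn_iff]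
  intro ε hε
  filter_upwards [hD.eventually_lt_const hε] with n hn z hz
  refine lt_of_le_of_lt ?_ hn
  have hsum {b : ℕ → ℂ} (hb : ∀ j, ‖b j‖ ≤ B) : Summable fun j => b j * z ^ j := by
    refine Summable.of_norm_bounded (hgeom.mul_left B) fun j => ?_
    rw [norm_mul, norm_pow]
    exact mul_le_mul (hb j) (pow_le_pow_left₀ (norm_nonneg _) (hKr z hz) _) (by positivity) hB0
  have h1 := Complex.taylorSeries_eq_on_ball' (hKU hz) (hv (φ n))
  simp only [sub_zero] at h1
  rw [dist_comm, dist_eq_norm, ← h1, ← (hsum (hAB (φ n))).tsum_sub (hsum haB)]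
  have hbd (j : ℕ) : ‖A (φ n) j * z ^ j - a j * z ^ j‖ ≤ ‖A (φ n) j - a j‖ * r ^ j := by
    rw [← sub_mul, norm_mul, norm_pow]
    exact mul_le_mul_of_nonneg_left (pow_le_pow_left₀ (norm_nonneg _) (hKr z hz) _) (norm_nonneg _)
  refine tsum_of_norm_bounded (Summable.hasSum ?_) hbd
  refine Summable.of_nonneg_of_le (fun j => by positivity) (fun j => ?_) (hgeom.mul_left (B + B))
  exact mul_le_mul_of_nonneg_right ((norm_sub_le _ _).trans (add_le_add (hAB _ _) (haB _)))
    (by positivity)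

/-- **Hurwitz's theorem**: a limit of zero-free functions which is not locally zero is
zero-free. -/
lemma ne_zero_of_tendstoLocallyUniformlyOn {v : ℕ → ℂ → ℂ} {V : ℂ → ℂ} {U : Set ℂ}
    (hU : IsOpen U) (hv : ∀ n, DifferentiableOn ℂ (v n) U) (hv0 : ∀ n, ∀ z ∈ U, v n z ≠ 0)
    (hlim : TendstoLocallyUniformlyOn v V atTop U) {z₀ : ℂ} (hz₀ : z₀ ∈ U)
    (hV : ∃ᶠ z in 𝓝 z₀, V z ≠ 0) : V z₀ ≠ 0 := by
  intro hzero
  have hVd : DifferentiableOn ℂ V U := hlim.differentiableOn (.of_forall hv) hU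
  have hVan : AnalyticAt ℂ V z₀ := hVd.analyticAt (hU.mem_nhds hz₀)
  have hne : ∀ᶠ z in 𝓝[≠] z₀, V z ≠ 0 := by
    rcases hVan.eventually_eq_zero_or_eventually_ne_zero with h | h
    · exact absurd (h.mono fun z hz hz' => hz' hz) hV
    · exact h
  obtain ⟨R, hR, hball⟩ := Metric.eventually_nhds_iff_ball.1
    ((eventually_nhdsWithin_iff.1 hne).and (hU.eventually_mem hz₀))
  set r := R / 2 with hr
  have hr0 : 0 < r := by positivity
  have hcl : closedBall z₀ r ⊆ U := fun z hz =>
    (hball z (closedBall_subset_ball (by linarith) hz)).2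
  have hsphere : ∀ z ∈ sphere z₀ r, V z ≠ 0 := fun z hz =>
    (hball z (closedBall_subset_ball (by linarith) (sphere_subset_closedBall hz))).1
      (ne_of_mem_sphere hz hr0.ne')
  obtain ⟨x, hx, hmin⟩ := (isCompact_sphere z₀ r).exists_isMinOn
    (NormedSpace.sphere_nonempty.2 hr0.le)
    ((hVd.continuousOn.mono (sphere_subset_closedBall.trans hcl)).norm)
  set δ := ‖V x‖ with hδ
  have hδ0 : 0 < δ := norm_pos_iff.2 (hsphere x hx)
  have hunif := (tendstoLocallyUniformlyOn_iff_forall_isCompact hU).1 hlim _ hcl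
    (isCompact_closedBall z₀ r)
  obtain ⟨n, hn⟩ := (Metric.tendstoUniformlyOn_iff.1 hunif (δ / 2) (by positivity)).exists
  have hinv : DifferentiableOn ℂ (fun z => (v n z)⁻¹) U := (hv n).inv (hv0 n)
  have hle := Complex.norm_le_of_forall_mem_frontier_norm_le (isBounded_ball (x := z₀) (r := r))
    (DifferentiableOn.diffContOnCl_ball (hinv.mono hcl) subset_rfl) (C := (δ / 2)⁻¹)
    (fun z hz => by
      rw [frontier_ball _ hr0.ne'] at hz
      have h1 := hn z (sphere_subset_closedBall hz)
      have h2 : δ ≤ ‖V z‖ := hmin hz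
      have h3 := norm_sub_norm_le (V z) (v n z)
      rw [dist_eq_norm] at h1
      rw [norm_inv]
      exact inv_anti₀ (by positivity) (by linarith))
    (subset_closure (mem_ball_self hr0))
  rw [norm_inv] at hle
  have h1 := hn z₀ (mem_closedBall_self hr0.le)
  rw [hzero, dist_zero_left] at h1
  have h2 := (inv_le_inv₀ (norm_pos_iff.2 (hv0 n z₀ hz₀)) (by positivity)).1 hle
  linarith

lemma TendstoLocallyUniformlyOn.iteratedDeriv' {v : ℕ → ℂ → ℂ} {V : ℂ → ℂ} {U : Set ℂ}
    (hU : IsOpen U) (hv : ∀ n, DifferentiableOn ℂ (v n) U)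
    (hlim : TendstoLocallyUniformlyOn v V atTop U) (j : ℕ) :
    TendstoLocallyUniformlyOn (fun n => iteratedDeriv j (v n)) (iteratedDeriv j V) atTop U := by
  induction j with
  | zero => simpa using hlim
  | succ j ih =>
    simp only [iteratedDeriv_succ]
    exact ih.deriv (.of_forall fun n =>
      (analyticOnNhd_iteratedDeriv ((hv n).analyticOnNhd hU) j).differentiableOn) hU

/-- Convergence of derivatives implies convergence of the normalized primitives. -/
lemma tendstoLocallyUniformlyOn_of_hasDerivAt {H h : ℕ → ℂ → ℂ} {H₀ h₀ : ℂ → ℂ}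
    (hH : ∀ n, ∀ z ∈ unitDisk, HasDerivAt (H n) (h n z) z) (hH0 : ∀ n, H n 0 = 0)
    (hH₀ : ∀ z ∈ unitDisk, HasDerivAt H₀ (h₀ z) z) (hH₀0 : H₀ 0 = 0)
    (hlim : TendstoLocallyUniformlyOn h h₀ atTop unitDisk) :
    TendstoLocallyUniformlyOn H H₀ atTop unitDisk := by
  rw [tendstoLocallyUniformlyOn_iff_forall_isCompact isOpen_unitDisk] at hlim ⊢
  intro K hKU hK
  obtain ⟨r, hr0, hr1, hKr⟩ := exists_radius_of_isCompact hKU hK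
  have hsub : closedBall (0 : ℂ) r ⊆ unitDisk := closedBall_subset_ball hr1
  have hu := hlim _ hsub (isCompact_closedBall 0 r)
  rw [Metric.tendstoUniformlyOn_iff] at hu ⊢
  intro ε hε
  filter_upwards [hu (ε / 2) (by positivity)] with n hn z hz
  have hz' : z ∈ closedBall (0 : ℂ) r := mem_closedBall_zero_iff.2 (hKr z hz)
  have := (convex_closedBall (0 : ℂ) r).norm_image_sub_le_of_norm_hasDerivWithin_le
    (f := fun w => H₀ w - H n w) (C := ε / 2)
    (fun w hw => ((hH₀ w (hsub hw)).sub (hH n w (hsub hw))).hasDerivWithinAt)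
    (fun w hw => by rw [← dist_eq_norm]; exact (hn w hw).le) (mem_closedBall_self hr0) hz'
  rw [hH0, hH₀0, sub_zero, sub_zero, sub_zero] at this
  rw [dist_eq_norm]
  have hzr := hKr z hz
  nlinarith

lemma sphDist_nonneg (x y : OnePoint ℂ) : 0 ≤ sphDist x y := by
  cases x <;> cases y <;> simp only [sphDist, Option.elim] <;>
    positivity

lemma sphDist_coe_coe_le (z w : ℂ) : sphDist (z : OnePoint ℂ) (w : OnePoint ℂ) ≤ ‖z - w‖ := by
  change ‖z - w‖ / (Real.sqrt (1 + ‖z‖ ^ 2) * Real.sqrt (1 + ‖w‖ ^ 2)) ≤ ‖z - w‖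
  have h (z : ℂ) : 1 ≤ Real.sqrt (1 + ‖z‖ ^ 2) :=
    Real.one_le_sqrt.2 (le_add_of_nonneg_right (by positivity))
  exact div_le_self (norm_nonneg _) (one_le_mul_of_one_le_of_one_le (h z) (h w))

lemma sphDist_coe_infty_le {z : ℂ} (hz : z ≠ 0) : sphDist (z : OnePoint ℂ) OnePoint.infty ≤ ‖z‖⁻¹ := by
  change 1 / Real.sqrt (1 + ‖z‖ ^ 2) ≤ ‖z‖⁻¹
  rw [one_div]
  exact inv_anti₀ (norm_pos_iff.2 hz) (Real.le_sqrt_of_sq_le (by linarith))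

lemma tendstoLocUnifSph_of_tendsto {F : ℕ → ℂ → ℂ} {g : ℂ → OnePoint ℂ} {U : Set ℂ}
    (h : ∀ x ∈ U, Tendsto (fun p : ℕ × ℂ => sphDist (F p.1 p.2 : OnePoint ℂ) (g p.2))
      (atTop ×ˢ 𝓝[U] x) (𝓝 0)) : TendstoLocUnifSph F g U := by
  intro ε hε x hx
  obtain ⟨pa, hpa, pb, hpb, hp⟩ := eventually_prod_iff.1 ((h x hx).eventually_lt_const hε)
  exact ⟨{y | pb y}, hpb, hpa.mono fun n hn y hy => hp hn hy⟩

lemma tendstoLocUnifSph_coe {F : ℕ → ℂ → ℂ} {g : ℂ → ℂ} {U : Set ℂ} (hg : ContinuousOn g U)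
    (h : ∀ x ∈ U, Tendsto (fun p : ℕ × ℂ => F p.1 p.2) (atTop ×ˢ 𝓝[U] x) (𝓝 (g x))) :
    TendstoLocUnifSph F (fun z => (g z : OnePoint ℂ)) U := by
  refine tendstoLocUnifSph_of_tendsto fun x hx => ?_
  have h1 := ((h x hx).sub ((hg x hx).tendsto.comp tendsto_snd)).norm
  rw [sub_self, norm_zero] at h1
  exact squeeze_zero (fun p => sphDist_nonneg _ _) (fun p => sphDist_coe_coe_le _ _) h1

lemma tendstoLocUnifSph_infty {F : ℕ → ℂ → ℂ} {U : Set ℂ}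
    (h : ∀ x ∈ U, Tendsto (fun p : ℕ × ℂ => ‖F p.1 p.2‖) (atTop ×ˢ 𝓝[U] x) atTop) :
    TendstoLocUnifSph F (fun _ => OnePoint.infty) U := by
  refine tendstoLocUnifSph_of_tendsto fun x hx => ?_
  refine squeeze_zero' (.of_forall fun p => sphDist_nonneg _ _) ?_
    (tendsto_inv_atTop_zero.comp (h x hx))
  filter_upwards [(h x hx).eventually_gt_atTop 0] with p hp
  exact sphDist_coe_infty_le (norm_pos_iff.1 hp)

lemma exists_subseq_tendsto_or_norm_tendsto_atTop (x : ℕ → ℂ) :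
    ∃ φ : ℕ → ℕ, StrictMono φ ∧ ((∃ a, Tendsto (x ∘ φ) atTop (𝓝 a)) ∨
      Tendsto (fun n => ‖x (φ n)‖) atTop atTop) := by
  by_cases h : ∃ R : ℝ, ∃ᶠ n in atTop, x n ∈ closedBall (0 : ℂ) R
  · obtain ⟨R, hR⟩ := h
    obtain ⟨a, -, φ, hφ, ha⟩ := tendsto_subseq_of_frequently_bounded isBounded_closedBall hR
    exact ⟨φ, hφ, .inl ⟨a, ha⟩⟩
  · refine ⟨id, strictMono_id, .inr (tendsto_atTop.2 fun R => ?_)⟩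
    have := not_frequently.1 (not_exists.1 h R)
    filter_upwards [this] with n hn
    rw [mem_closedBall_zero_iff, not_le] at hn
    exact hn.le

lemma tendsto_norm_add_atTop {α : Type*} {l : Filter α} {f g : α → ℂ} {y : ℂ}
    (hf : Tendsto (fun p => ‖f p‖) l atTop) (hg : Tendsto g l (𝓝 y)) :
    Tendsto (fun p => ‖f p + g p‖) l atTop := by
  refine tendsto_atTop_mono (fun p => ?_) (hf.atTop_add hg.norm.neg)
  have := norm_sub_le (f p + g p) (g p)
  rw [add_sub_cancel_right] at this
  linarith

lemma exists_subseq_tendstoLocUnifSph_of_affine {F H : ℕ → ℂ → ℂ} {a c : ℕ → ℂ} {H₀ : ℂ → ℂ}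
    {U : Set ℂ} (hF : ∀ n, ∀ z ∈ U, F n z = a n + c n * H n z) (hc : ∀ n, c n ≠ 0)
    (hH : TendstoLocallyUniformlyOn H H₀ atTop U) (hH₀ : ContinuousOn H₀ U)
    (hacc : ∀ b : ℂ, NoAccIn {z ∈ U | b + H₀ z = 0} U) :
    ∃ φ : ℕ → ℕ, StrictMono φ ∧ ∃ E : Set ℂ, E ⊆ U ∧ NoAccIn E U ∧
      ∃ g : ℂ → OnePoint ℂ, TendstoLocUnifSph (fun n => F (φ n)) g (U \ E) := by
  have hlim (φ : ℕ → ℕ) (hφ : StrictMono φ) (x : ℂ) (hx : x ∈ U) :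
      Tendsto (fun p : ℕ × ℂ => H (φ p.1) p.2) (atTop ×ˢ 𝓝[U] x) (𝓝 (H₀ x)) := by
    have h1 := tendstoUniformlyOnFilter_iff_tendsto.1
      (tendstoLocallyUniformlyOn_iff_filter.1 hH x hx)
    have h2 := (Uniform.tendsto_congr h1).1 ((hH₀ x hx).tendsto.comp tendsto_snd)
    exact h2.comp (hφ.tendsto_atTop.prodMap tendsto_id)
  have hmem (x : ℂ) : ∀ᶠ p : ℕ × ℂ in atTop ×ˢ 𝓝[U] x, p.2 ∈ U :=
    tendsto_snd.eventually self_mem_nhdsWithin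
  have hempty : NoAccIn (∅ : Set ℂ) U := fun z _ => by simp [accPt_iff_frequently_nhdsNE, -principal_empty]
  obtain ⟨φ, hφ, hcφ⟩ := exists_subseq_tendsto_or_norm_tendsto_atTop c
  rcases hcφ with ⟨c₀, hc₀⟩ | hcinf
  · obtain ⟨ψ, hψ, haψ⟩ := exists_subseq_tendsto_or_norm_tendsto_atTop (a ∘ φ)
    have hcψ : Tendsto (fun n => c (φ (ψ n))) atTop (𝓝 c₀) := hc₀.comp hψ.tendsto_atTop
    refine ⟨φ ∘ ψ, hφ.comp hψ, ∅, empty_subset _, hempty, ?_⟩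
    rw [sdiff_empty]
    have hprod (x : ℂ) (hx : x ∈ U) := (hcψ.comp tendsto_fst).mul (hlim _ (hφ.comp hψ) x hx)
    rcases haψ with ⟨a₀, ha₀⟩ | hainf
    · refine ⟨_, tendstoLocUnifSph_coe (g := fun z => a₀ + c₀ * H₀ z)
        (continuousOn_const.add (continuousOn_const.mul hH₀)) fun x hx => ?_⟩
      refine ((ha₀.comp tendsto_fst).add (hprod x hx)).congr' ?_
      filter_upwards [hmem x] with p hp
      simp [hF _ _ hp]
    · refine ⟨_, tendstoLocUnifSph_infty fun x hx => ?_⟩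
      refine (tendsto_norm_add_atTop (hainf.comp tendsto_fst) (hprod x hx)).congr' ?_
      filter_upwards [hmem x] with p hp
      simp [hF _ _ hp]
  · obtain ⟨ψ, hψ, hbψ⟩ := exists_subseq_tendsto_or_norm_tendsto_atTop
      (fun n => a (φ n) / c (φ n))
    have hcψ : Tendsto (fun n => ‖c (φ (ψ n))‖) atTop atTop := hcinf.comp hψ.tendsto_atTop
    have hFc (n : ℕ) (z : ℂ) (hz : z ∈ U) :
        ‖F (φ (ψ n)) z‖ = ‖c (φ (ψ n))‖ *
          ‖a (φ (ψ n)) / c (φ (ψ n)) + H (φ (ψ n)) z‖ := by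
      rw [hF _ _ hz, ← norm_mul, mul_add, mul_div_cancel₀ _ (hc _)]
    rcases hbψ with ⟨b₀, hb₀⟩ | hbinf
    · refine ⟨φ ∘ ψ, hφ.comp hψ, {z ∈ U | b₀ + H₀ z = 0}, fun z hz => hz.1, hacc b₀, _,
        tendstoLocUnifSph_infty fun x hx => ?_⟩
      have hx0 : b₀ + H₀ x ≠ 0 := fun h => hx.2 ⟨hx.1, h⟩
      have hle : (atTop ×ˢ 𝓝[U \ {z ∈ U | b₀ + H₀ z = 0}] x : Filter (ℕ × ℂ)) ≤
          atTop ×ˢ 𝓝[U] x := prod_mono le_rfl (nhdsWithin_mono _ sdiff_subset)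
      refine Tendsto.mono_left ?_ hle
      refine ((hcψ.comp tendsto_fst).atTop_mul_pos (norm_pos_iff.2 hx0)
        ((hb₀.comp tendsto_fst).add (hlim _ (hφ.comp hψ) x hx.1)).norm).congr' ?_
      filter_upwards [hmem x] with p hp
      simp [hFc _ _ hp]
    · refine ⟨φ ∘ ψ, hφ.comp hψ, ∅, empty_subset _, hempty, _,
        tendstoLocUnifSph_infty fun x hx => ?_⟩
      rw [sdiff_empty] at hx ⊢
      refine ((hcψ.comp tendsto_fst).atTop_mul_atTop₀ (tendsto_norm_add_atTop
        (hbinf.comp tendsto_fst) (hlim _ (hφ.comp hψ) x hx))).congr' ?_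
      filter_upwards [hmem x] with p hp
      simp [hFc _ _ hp]

lemma noAccIn_of_hasDerivAt_ne_zero {H h : ℂ → ℂ} (hH : ∀ z ∈ unitDisk, HasDerivAt H (h z) z)
    (hh : ∀ z ∈ unitDisk, h z ≠ 0) (b : ℂ) : NoAccIn {z ∈ unitDisk | b + H z = 0} unitDisk := by
  intro z hz
  rw [accPt_iff_frequently_nhdsNE, not_frequently]
  filter_upwards [(hH z hz).eventually_ne (c := -b) (hh z hz)] with w hw hw'
  exact hw (by linear_combination hw'.2)

/-- For every `k ∈ ℕ` and `M ∈ ℝ`, the family `H_{k,M}` is quasi-normal on `𝔻`. -/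
theorem HFam_quasiNormal (k : ℕ) (hk : 1 ≤ k) (M : ℝ) :
    QuasiNormalOn (HFam k M) unitDisk := by
  intro F hF
  have h0 : (0 : ℂ) ∈ unitDisk := mem_ball_self one_pos
  choose v c hc hv hv0 hFv hvB hv1 using fun n => exists_normalized_root hk (hF n)
  obtain ⟨φ, hφ, V, hV⟩ := exists_subseq_tendstoLocallyUniformlyOn hv hvB
  have hVd : DifferentiableOn ℂ V unitDisk :=
    hV.differentiableOn (.of_forall fun n => hv _) isOpen_unitDisk
  have hVnorm : ‖fun i : Fin k => iteratedDeriv i V 0‖ = 1 := by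
    have h1 : Tendsto (fun n => fun i : Fin k => iteratedDeriv i (v (φ n)) 0) atTop
        (𝓝 fun i : Fin k => iteratedDeriv i V 0) := tendsto_pi_nhds.2 fun i =>
      (hV.iteratedDeriv' isOpen_unitDisk (fun n => hv _) i).tendsto_at h0
    have h2 := h1.norm
    simp only [hv1] at h2
    exact (tendsto_nhds_unique h2 tendsto_const_nhds)
  have hVne (z : ℂ) (hz : z ∈ unitDisk) : V z ≠ 0 := by
    refine ne_zero_of_tendstoLocallyUniformlyOn isOpen_unitDisk (fun n => hv _)
      (fun n => hv0 _) hV hz fun h => ?_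
    have hzero : EqOn V 0 unitDisk :=
      (hVd.analyticOnNhd isOpen_unitDisk).eqOn_zero_of_preconnected_of_eventuallyEq_zero
        (convex_ball (0 : ℂ) 1).isPreconnected hz (h.mono fun w hw => not_not.1 hw)
    have hev : V =ᶠ[𝓝 0] fun _ => (0 : ℂ) := by
      filter_upwards [isOpen_unitDisk.mem_nhds h0] with w hw using hzero hw
    have : (fun i : Fin k => iteratedDeriv i V 0) = 0 := by
      ext i
      rw [hev.iteratedDeriv_eq]
      simp
    rw [this, norm_zero] at hVnorm
    exact zero_ne_one hVnorm
  have hpow : TendstoLocallyUniformlyOn (fun n z => (v (φ n) z ^ k)⁻¹) (fun z => (V z ^ k)⁻¹)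
      atTop unitDisk := by
    have : TendstoLocallyUniformlyOn (fun n z => v (φ n) z ^ k) (fun z => V z ^ k)
        atTop unitDisk := by
      clear * - hV hVd
      induction k with
      | zero =>
        simp only [pow_zero]
        exact fun u hu x hx => ⟨univ, univ_mem, .of_forall fun n y _ => refl_mem_uniformity hu⟩
      | succ j ih =>
        simp only [pow_succ]
        exact ih.mul₀ hV (hVd.continuousOn.pow j) hVd.continuousOn
    exact this.inv₀ (hVd.continuousOn.pow k) fun z hz => pow_ne_zero _ (hVne z hz)
  obtain ⟨H₀, hH₀0, hH₀⟩ := Complex.IsExactOn.with_val_at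
    (DifferentiableOn.isExactOn_ball (c := (0 : ℂ)) (r := 1)
      ((hVd.pow k).inv fun z hz => pow_ne_zero _ (hVne z hz))) 0 0
  have hH : TendstoLocallyUniformlyOn (fun n z => (F (φ n) z - F (φ n) 0) / c (φ n)) H₀
      atTop unitDisk := by
    refine tendstoLocallyUniformlyOn_of_hasDerivAt (fun n z hz => ?_) (by simp) hH₀ hH₀0 hpow
    have h1 := ((hF (φ n)).2 z hz).differentiableAt.hasDerivAt
    rw [hFv _ _ hz] at h1
    have h2 := (h1.sub_const (F (φ n) 0)).div_const (c (φ n))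
    rwa [mul_div_cancel_left₀ _ (hc _)] at h2
  obtain ⟨ψ, hψ, E, hE, hacc, g, hg⟩ := exists_subseq_tendstoLocUnifSph_of_affine
    (F := fun n => F (φ n)) (a := fun n => F (φ n) 0) (c := fun n => c (φ n))
    (fun n z _ => by rw [mul_div_cancel₀ _ (hc _)]; ring) (fun n => hc _) hH
    (fun z hz => (hH₀ z hz).continuousAt.continuousWithinAt)
    (noAccIn_of_hasDerivAt_ne_zero hH₀ fun z hz => inv_ne_zero (pow_ne_zero _ (hVne z hz)))
  exact ⟨φ ∘ ψ, hφ.comp hψ, E, hE, hacc, g, hg⟩
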